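/- If H¹(k,k*) = {0}, then for every K-vector space z there are no non-zero coupled 2-cocycles on g = A⊗k; more precisely, every 2-cocycle of the form f₁∘p₁ + f₂∘p₂ has both f₁∘p₁ and f₂∘p₂ 2-cocycles. -/

import Mathlib

set_option linter.unusedSectionVars false
set_option synthInstance.maxHeartbeats 1000000
set_option maxHeartbeats 1000000
open scoped TensorProduct

namespace CurrentPaper

variable (K : Type*) [Field K] [CharZero K]

section Wedge

variable (V : Type*) [AddCommGroup V] [Module K V]

/-- `x ∧ y = (1/2)(x ⊗ y - y ⊗ x)` inside `V ⊗ V`. -/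
noncomputable def wedge (x y : V) : V ⊗[K] V := (2 : K)⁻¹ • (x ⊗ₜ[K] y - y ⊗ₜ[K] x)

/-- `x ∨ y = (1/2)(x ⊗ y + y ⊗ x)` inside `V ⊗ V`. -/
noncomputable def vee (x y : V) : V ⊗[K] V := (2 : K)⁻¹ • (x ⊗ₜ[K] y + y ⊗ₜ[K] x)

/-- `Λ²(V)` realized as the subspace of skew-symmetric tensors of `V ⊗ V`. -/
def lambda2 : Submodule K (V ⊗[K] V) := Submodule.span K {t | ∃ x y : V, t = wedge K V x y}

/-- `S²(V)` realized as the subspace of symmetric tensors of `V ⊗ V`. -/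
def sym2 : Submodule K (V ⊗[K] V) := Submodule.span K {t | ∃ x y : V, t = vee K V x y}

variable {V}

lemma wedge_mem (x y : V) : wedge K V x y ∈ lambda2 K V := Submodule.subset_span ⟨x, y, rfl⟩

lemma vee_mem (x y : V) : vee K V x y ∈ sym2 K V := Submodule.subset_span ⟨x, y, rfl⟩

end Wedge

section LieRelaxed

variable (L : Type*) [LieRing L] [Module K L]

/-- `∂(u ∧ v ∧ w) = ⁅u,v⁆ ∧ w + ⁅v,w⁆ ∧ u + ⁅w,u⁆ ∧ v`. -/
noncomputable def dd (u v w : L) : L ⊗[K] L :=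
  wedge K L ⁅u, v⁆ w + wedge K L ⁅v, w⁆ u + wedge K L ⁅w, u⁆ v

/-- `B₂(L)`, the space of 2-boundaries, i.e. the image of `∂ : Λ³(L) → Λ²(L)`. -/
def B2 : Submodule K (L ⊗[K] L) := Submodule.span K {t | ∃ u v w : L, t = dd K L u v w}

variable {L}

lemma dd_mem_lambda2 (u v w : L) : dd K L u v w ∈ lambda2 K L :=
  add_mem (add_mem (wedge_mem K _ _) (wedge_mem K _ _)) (wedge_mem K _ _)

lemma dd_mem_B2 (u v w : L) : dd K L u v w ∈ B2 K L := Submodule.subset_span ⟨u, v, w, rfl⟩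

end LieRelaxed

section Lie

variable (L : Type*) [LieRing L] [LieAlgebra K L]

/-- The bracket `b : L ⊗ L → L`, `u ⊗ v ↦ ⁅u,v⁆`, as a linear map. -/
noncomputable def bracketHom : L ⊗[K] L →ₗ[K] L :=
  TensorProduct.lift (LinearMap.mk₂ K (fun u v => ⁅u, v⁆) add_lie smul_lie lie_add lie_smul)

/-- `Z₂(L) = Λ²(L) ∩ ker b`, the space of 2-cycles. -/
noncomputable def Z2 : Submodule K (L ⊗[K] L) := lambda2 K L ⊓ LinearMap.ker (bracketHom K L)

/-- The derived algebra `L' = [L,L]`, as a subspace of `L`. -/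
def derived : Submodule K L := Submodule.span K {m | ∃ u v : L, m = ⁅u, v⁆}

end Lie

section Alg

variable (A : Type*) [CommRing A] [Algebra K A]

/-- `I_A ⊆ S²(A)`: the kernel of the multiplication map `S²(A) → A`. -/
noncomputable def ia : Submodule K (A ⊗[K] A) := sym2 K A ⊓ LinearMap.ker (LinearMap.mul' K A)

/-- `T(A) ⊆ Λ²(A)`: the span of the elements `ab ∧ c + bc ∧ a + ca ∧ b`. -/
def TA : Submodule K (A ⊗[K] A) :=
  Submodule.span K
    {t | ∃ a b c : A, t = wedge K A (a*b) c + wedge K A (b*c) a + wedge K A (c*a) b}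

/-- `T₀(A) ⊆ Λ²(A)`: the span of the elements `ab ∧ c + bc ∧ a + ca ∧ b - abc ∧ 1`. -/
def T0A : Submodule K (A ⊗[K] A) :=
  Submodule.span K
    {t | ∃ a b c : A,
      t = wedge K A (a*b) c + wedge K A (b*c) a + wedge K A (c*a) b - wedge K A (a*b*c) 1}

variable {A}

lemma TA_el_mem_lambda2 (a b c : A) :
    wedge K A (a*b) c + wedge K A (b*c) a + wedge K A (c*a) b ∈ lambda2 K A :=
  add_mem (add_mem (wedge_mem K _ _) (wedge_mem K _ _)) (wedge_mem K _ _)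

lemma T0A_el_mem_lambda2 (a b c : A) :
    wedge K A (a*b) c + wedge K A (b*c) a + wedge K A (c*a) b - wedge K A (a*b*c) 1 ∈
      lambda2 K A :=
  sub_mem (TA_el_mem_lambda2 K a b c) (wedge_mem K _ _)

lemma ia_el_mem (a b : A) : vee K A a b - vee K A (a * b) 1 ∈ ia K A := by
  refine Submodule.mem_inf.mpr ⟨sub_mem (vee_mem K a b) (vee_mem K _ _), ?_⟩
  simp only [LinearMap.mem_ker, map_sub, vee, map_smul, map_add, LinearMap.mul'_apply,
    mul_one, one_mul, mul_comm b a]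
  simp

end Alg

section Current

variable (A : Type*) [CommRing A] [Algebra K A]
variable (k : Type*) [LieRing k] [LieAlgebra K k]

lemma g_smul_lie (c : K) (x y : A ⊗[K] k) : ⁅c • x, y⁆ = c • ⁅x, y⁆ := by
  rw [← algebraMap_smul A c x, ← algebraMap_smul A c ⁅x, y⁆, smul_lie]

lemma g_lie_smul (c : K) (x y : A ⊗[K] k) : ⁅x, c • y⁆ = c • ⁅x, y⁆ := by
  rw [← algebraMap_smul A c y, ← algebraMap_smul A c ⁅x, y⁆, lie_smul]

/-- The bracket of the current algebra `g = A ⊗ k`, as a `K`-linear map `g ⊗ g → g`. -/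
noncomputable def gBracket : (A ⊗[K] k) ⊗[K] (A ⊗[K] k) →ₗ[K] A ⊗[K] k :=
  TensorProduct.lift (LinearMap.mk₂ K (fun u v => ⁅u, v⁆) add_lie
    (fun c x y => g_smul_lie K A k c x y) lie_add (fun c x y => g_lie_smul K A k c x y))

/-- `Z₂(g) = Λ²(g) ∩ ker b` for the current algebra `g = A ⊗ k`. -/
noncomputable def Z2g : Submodule K ((A ⊗[K] k) ⊗[K] (A ⊗[K] k)) :=
  lambda2 K (A ⊗[K] k) ⊓ LinearMap.ker (gBracket K A k)

/-- The first summand `Λ²(A) ⊗ S²(k)` of the decomposition of `Λ²(A ⊗ k)`. -/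
abbrev M1 := (↥(lambda2 K A)) ⊗[K] (↥(sym2 K k))

/-- The second summand `A ⊗ Λ²(k)` of the decomposition of `Λ²(A ⊗ k)`. -/
abbrev M2 := A ⊗[K] (↥(lambda2 K k))

/-- The third summand `I_A ⊗ Λ²(k)` of the decomposition of `Λ²(A ⊗ k)`. -/
abbrev M3 := (↥(ia K A)) ⊗[K] (↥(lambda2 K k))

/-- The target of the isomorphism `P = (p₁,p₂,p₃)`. -/
abbrev Wspace := M1 K A k × M2 K A k × M3 K A k

variable {A k}

/-- The property characterizing the linear isomorphism
`P = (p₁,p₂,p₃) : Λ²(A ⊗ k) ≅ (Λ²(A) ⊗ S²(k)) ⊕ (A ⊗ Λ²(k)) ⊕ (I_A ⊗ Λ²(k))`: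
`p₁(ax ∧ by) = a ∧ b ⊗ x ∨ y`, `p₂(ax ∧ by) = ab ⊗ x ∧ y`,
`p₃(ax ∧ by) = (a ∨ b - ab ∨ 1) ⊗ x ∧ y`. -/
def IsDecomposition (P : ↥(lambda2 K (A ⊗[K] k)) ≃ₗ[K] Wspace K A k) : Prop :=
  ∀ (a b : A) (x y : k),
    P ⟨wedge K (A ⊗[K] k) (a ⊗ₜ x) (b ⊗ₜ y), wedge_mem K _ _⟩ =
      ((⟨wedge K A a b, wedge_mem K a b⟩ ⊗ₜ[K] ⟨vee K k x y, vee_mem K x y⟩ : M1 K A k),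
       ((a * b) ⊗ₜ[K] ⟨wedge K k x y, wedge_mem K x y⟩ : M2 K A k),
       ((⟨vee K A a b - vee K A (a * b) 1, ia_el_mem K a b⟩ ⊗ₜ[K]
          ⟨wedge K k x y, wedge_mem K x y⟩ : M3 K A k)))

end Current

end CurrentPaper

namespace CurrentPaper

section Helpers

variable {K : Type*} [Field K] [CharZero K]

section Bilinear

variable {V : Type*} [AddCommGroup V] [Module K V]

lemma wedge_add_left (x x' y : V) :
    wedge K V (x + x') y = wedge K V x y + wedge K V x' y := by
  simp only [wedge, TensorProduct.add_tmul, TensorProduct.tmul_add]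
  module

lemma wedge_add_right (x y y' : V) :
    wedge K V x (y + y') = wedge K V x y + wedge K V x y' := by
  simp only [wedge, TensorProduct.add_tmul, TensorProduct.tmul_add]
  module

lemma wedge_smul_left (c : K) (x y : V) : wedge K V (c • x) y = c • wedge K V x y := by
  simp only [wedge, ← TensorProduct.smul_tmul', TensorProduct.tmul_smul]
  module

lemma wedge_smul_right (c : K) (x y : V) : wedge K V x (c • y) = c • wedge K V x y := by
  simp only [wedge, ← TensorProduct.smul_tmul', TensorProduct.tmul_smul]
  module

lemma wedge_swap (x y : V) : wedge K V x y = -wedge K V y x := by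
  simp only [wedge]
  module

lemma vee_comm (x y : V) : vee K V x y = vee K V y x := by
  simp only [vee, add_comm]

variable (K) in
/-- The map `(x, y) ↦ x ∧ y` as a bilinear map. -/
noncomputable def wedgeHom : V →ₗ[K] V →ₗ[K] V ⊗[K] V :=
  LinearMap.mk₂ K (wedge K V) wedge_add_left wedge_smul_left wedge_add_right wedge_smul_right

end Bilinear

section Boundary

variable {L : Type*} [LieRing L] [Module K L]

lemma dd_add_left (u u' v w : L) : dd K L (u + u') v w = dd K L u v w + dd K L u' v w := by
  simp only [dd, add_lie, lie_add, wedge_add_left, wedge_add_right]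
  abel

lemma dd_rotate (u v w : L) : dd K L u v w = dd K L v w u := by
  simp only [dd]
  abel

lemma dd_zero_left (v w : L) : dd K L 0 v w = 0 := by
  simpa using dd_add_left (K := K) 0 0 v w

end Boundary

/-- A linear map vanishes on `B₂(A ⊗ k)` as soon as it kills the boundaries of pure tensors. -/
lemma eq_zero_of_mem_B2 {A : Type*} [CommRing A] [Algebra K A] {k : Type*} [LieRing k]
    [LieAlgebra K k] {z : Type*} [AddCommGroup z] [Module K z]
    (H : (A ⊗[K] k) ⊗[K] (A ⊗[K] k) →ₗ[K] z)
    (h : ∀ (a b c : A) (x y w : k),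
      H (dd K (A ⊗[K] k) (a ⊗ₜ x) (b ⊗ₜ y) (c ⊗ₜ w)) = 0)
    {t : (A ⊗[K] k) ⊗[K] (A ⊗[K] k)} (ht : t ∈ B2 K (A ⊗[K] k)) : H t = 0 := by
  suffices B2 K (A ⊗[K] k) ≤ LinearMap.ker H from this ht
  refine Submodule.span_le.mpr ?_
  rintro _ ⟨u, v, w, rfl⟩
  change H _ = 0
  induction u with
  | zero => simp [dd_zero_left]
  | add u u' hu hu' => rw [dd_add_left, map_add, hu, hu', add_zero]
  | tmul a x =>
    rw [dd_rotate]
    induction v with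
    | zero => simp [dd_zero_left]
    | add v v' hv hv' => rw [dd_add_left, map_add, hv, hv', add_zero]
    | tmul b y =>
      rw [dd_rotate]
      induction w with
      | zero => simp [dd_zero_left]
      | add w w' hw hw' => rw [dd_add_left, map_add, hw, hw', add_zero]
      | tmul c w => rw [dd_rotate, h]

/-- If `H¹(L, L*) = 0`, a symmetric form `φ` and an alternating form `β` which satisfy the
coupling identity force `β` to be a 2-cocycle. -/
lemma cocycle_of_coupling {L : Type*} [LieRing L] [LieAlgebra K L]
    (hH1 : ∀ ω : L →ₗ[K] Module.Dual K L,
      (∀ x y w : L, ω ⁅x, y⁆ w = -(ω y ⁅x, w⁆) + ω x ⁅y, w⁆) →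
      ∃ χ : Module.Dual K L, ∀ x w : L, ω x w = -(χ ⁅x, w⁆))
    {z : Type*} [AddCommGroup z] [Module K z] (φ β : L →ₗ[K] L →ₗ[K] z)
    (hφ : ∀ x y, φ x y = φ y x) (hβ : ∀ x y, β x y = -β y x)
    (h : ∀ x y w, φ ⁅x, y⁆ w - φ ⁅y, w⁆ x + φ ⁅w, x⁆ y
      + (β ⁅x, y⁆ w + β ⁅y, w⁆ x + β ⁅w, x⁆ y) = 0) (x y w : L) :
    β ⁅x, y⁆ w + β ⁅y, w⁆ x + β ⁅w, x⁆ y = 0 := by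
  suffices hzero : ∀ x y, φ x y = 0 by simpa [hzero] using h x y w
  intro x y
  rw [← Module.forall_dual_apply_eq_zero_iff K]
  intro ψ
  have hψ (x y w : L) : ψ (φ ⁅x, y⁆ w) - ψ (φ ⁅y, w⁆ x) + ψ (φ ⁅w, x⁆ y)
      + (ψ (β ⁅x, y⁆ w) + ψ (β ⁅y, w⁆ x) + ψ (β ⁅w, x⁆ y)) = 0 := by
    simpa using congrArg ψ (h x y w)
  have hskew (B : L →ₗ[K] L →ₗ[K] z) (x y w : L) : ψ (B ⁅x, y⁆ w) = -ψ (B ⁅y, x⁆ w) := by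
    rw [← lie_skew x y, map_neg, LinearMap.neg_apply, map_neg]
  obtain ⟨χ, hχ⟩ := hH1 ((β - φ).compr₂ ψ) fun x y w => by
    have hβ₁ : ψ (β y ⁅x, w⁆) = ψ (β ⁅w, x⁆ y) := by
      rw [hβ, map_neg, hskew, neg_neg]
    have hβ₂ : ψ (β x ⁅y, w⁆) = -ψ (β ⁅y, w⁆ x) := by rw [hβ, map_neg]
    have hφ₁ : ψ (φ y ⁅x, w⁆) = -ψ (φ ⁅w, x⁆ y) := by rw [hφ, hskew]
    have hφ₂ : ψ (φ x ⁅y, w⁆) = ψ (φ ⁅y, w⁆ x) := by rw [hφ]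
    simp only [LinearMap.compr₂_apply, LinearMap.sub_apply, map_sub, hβ₁, hβ₂, hφ₁, hφ₂]
    linear_combination hψ w x y
  have h₁ := hχ x y
  have h₂ := hχ y x
  rw [← lie_skew, map_neg] at h₂
  simp only [LinearMap.compr₂_apply, LinearMap.sub_apply, map_sub, hφ y x, hβ y x,
    map_neg] at h₁ h₂
  linear_combination (-1 / 2 : K) * h₁ - (1 / 2 : K) * h₂

end Helpers

universe u₄

variable (K : Type*) [Field K] [CharZero K]
variable (A : Type*) [CommRing A] [Algebra K A]
variable (k : Type*) [LieRing k] [LieAlgebra K k]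

/-- If `H¹(k,k*) = {0}` (every 1-cocycle with values in the coadjoint
module is a coboundary), then for every `K`-vector space `z` there are no coupled
2-cocycles on `g = A ⊗ k`: for every 2-cocycle of the form `f₁∘p₁ + f₂∘p₂`, both
`f₁∘p₁` and `f₂∘p₂` are 2-cocycles. -/
theorem statement14
    (P : ↥(lambda2 K (A ⊗[K] k)) ≃ₗ[K] Wspace K A k) (hP : IsDecomposition K P)
    (hH1 : ∀ ω : k →ₗ[K] Module.Dual K k,
      (∀ x y w : k, ω ⁅x, y⁆ w = -(ω y ⁅x, w⁆) + ω x ⁅y, w⁆) →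
      ∃ φ : Module.Dual K k, ∀ x w : k, ω x w = -(φ ⁅x, w⁆)) :
    ∀ (z : Type u₄) [AddCommGroup z] [Module K z],
      ∀ (f1 : M1 K A k →ₗ[K] z) (f2 : M2 K A k →ₗ[K] z),
        (∀ t : ↥(lambda2 K (A ⊗[K] k)),
          (t : (A ⊗[K] k) ⊗[K] (A ⊗[K] k)) ∈ B2 K (A ⊗[K] k) →
            f1 (P t).1 + f2 (P t).2.1 = 0) →
        (∀ t : ↥(lambda2 K (A ⊗[K] k)),
          (t : (A ⊗[K] k) ⊗[K] (A ⊗[K] k)) ∈ B2 K (A ⊗[K] k) → f1 (P t).1 = 0) ∧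
        (∀ t : ↥(lambda2 K (A ⊗[K] k)),
          (t : (A ⊗[K] k) ⊗[K] (A ⊗[K] k)) ∈ B2 K (A ⊗[K] k) → f2 (P t).2.1 = 0) := by
  intro z _ _ f1 f2 h
  obtain ⟨H1, hH⟩ := LinearMap.exists_extend (f1 ∘ₗ LinearMap.fst K _ _ ∘ₗ P.toLinearMap)
  obtain ⟨H2, hH'⟩ := LinearMap.exists_extend
    (f2 ∘ₗ LinearMap.fst K _ _ ∘ₗ LinearMap.snd K _ _ ∘ₗ P.toLinearMap)
  have hp1 (t : ↥(lambda2 K (A ⊗[K] k))) : H1 t = f1 (P t).1 := LinearMap.congr_fun hH t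
  have hp2 (t : ↥(lambda2 K (A ⊗[K] k))) : H2 t = f2 (P t).2.1 := LinearMap.congr_fun hH' t
  have hw1 (a b : A) (x y : k) : H1 (wedge K _ (a ⊗ₜ x) (b ⊗ₜ y)) =
      f1 (⟨wedge K A a b, wedge_mem K a b⟩ ⊗ₜ[K] ⟨vee K k x y, vee_mem K x y⟩) := by
    simpa [hP a b x y] using hp1 ⟨_, wedge_mem K (a ⊗ₜ x) (b ⊗ₜ y)⟩
  have hw2 (a b : A) (x y : k) : H2 (wedge K _ (a ⊗ₜ x) (b ⊗ₜ y)) =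
      f2 ((a * b) ⊗ₜ[K] ⟨wedge K k x y, wedge_mem K x y⟩) := by
    simpa [hP a b x y] using hp2 ⟨_, wedge_mem K (a ⊗ₜ x) (b ⊗ₜ y)⟩
  have hw1_comm (a b : A) (x y : k) : H1 (wedge K _ (a ⊗ₜ x) (b ⊗ₜ y)) =
      H1 (wedge K _ (a ⊗ₜ y) (b ⊗ₜ x)) := by
    simp only [hw1, vee_comm x y]
  have hw2_mul (a b : A) (x y : k) : H2 (wedge K _ (a ⊗ₜ x) (b ⊗ₜ y)) =
      H2 (wedge K _ ((a * b) ⊗ₜ x) ((1 : A) ⊗ₜ y)) := by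
    simp only [hw2, mul_one]
  have hcoc (a : A) (x y w : k) :
      H2 (wedge K _ (a ⊗ₜ ⁅x, y⁆) ((1 : A) ⊗ₜ w)) + H2 (wedge K _ (a ⊗ₜ ⁅y, w⁆) ((1 : A) ⊗ₜ x))
        + H2 (wedge K _ (a ⊗ₜ ⁅w, x⁆) ((1 : A) ⊗ₜ y)) = 0 := by
    let B (H : (A ⊗[K] k) ⊗[K] (A ⊗[K] k) →ₗ[K] z) : k →ₗ[K] k →ₗ[K] z :=
      ((wedgeHom K).compr₂ H).compl₁₂ (TensorProduct.mk K A k a) (TensorProduct.mk K A k 1)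
    refine cocycle_of_coupling hH1 (B H1) (B H2) (hw1_comm a 1) (fun x y => ?_)
      (fun x y w => ?_) x y w
    · change H2 (wedge K _ (a ⊗ₜ x) ((1 : A) ⊗ₜ y)) = -H2 (wedge K _ (a ⊗ₜ y) ((1 : A) ⊗ₜ x))
      rw [wedge_swap, map_neg, hw2_mul 1 a, one_mul]
    · have key := h ⟨_, dd_mem_lambda2 K (a ⊗ₜ x) ((1 : A) ⊗ₜ y) ((1 : A) ⊗ₜ w)⟩
        (dd_mem_B2 K _ _ _)
      rw [← hp1, ← hp2] at key
      simp only [dd, LieAlgebra.ExtendScalars.bracket_tmul, mul_one, one_mul, map_add] at key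
      rw [wedge_swap ((1 : A) ⊗ₜ[K] ⁅y, w⁆), map_neg, map_neg, hw1_comm a 1 x, ← map_neg H2,
        ← wedge_swap, hw2_mul 1 a, one_mul] at key
      rw [← key]
      change H1 _ - H1 _ + H1 _ + (H2 _ + H2 _ + H2 _) = _
      simp only [TensorProduct.mk_apply]
      abel
  have hB2 {t : (A ⊗[K] k) ⊗[K] (A ⊗[K] k)} (ht : t ∈ B2 K (A ⊗[K] k)) : H2 t = 0 := by
    refine eq_zero_of_mem_B2 H2 (fun a b c x y w => ?_) ht
    simp only [dd, LieAlgebra.ExtendScalars.bracket_tmul, map_add]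
    rw [hw2_mul (a * b), hw2_mul (b * c), hw2_mul (c * a), show b * c * a = a * b * c by ring,
      show c * a * b = a * b * c by ring]
    exact hcoc _ x y w
  have hf2 (t : ↥(lambda2 K (A ⊗[K] k)))
      (ht : (t : (A ⊗[K] k) ⊗[K] (A ⊗[K] k)) ∈ B2 K (A ⊗[K] k)) : f2 (P t).2.1 = 0 := by
    rw [← hp2, hB2 ht]
  exact ⟨fun t ht => by simpa [hf2 t ht] using h t ht, hf2⟩

end CurrentPaper
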